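/- Let Q be a rack, A a commutative ring, and m ⊆ A an ideal with m² = 0. Let f: AQ² → AQ² be an entropic A-linear map whose matrix is congruent to the identity matrix modulo m. Then f is an automorphism of AQ² and c_Q ∘ f is a Yang-Baxter operator. -/

import Mathlib

open TensorProduct

noncomputable section

/-- A rack: a set with a binary operation `act x y = x ^ y` such that all right
translations are bijective and the operation is right self-distributive. -/
structure YBRack (Q : Type*) where
  act : Q → Q → Q
  act_bijective : ∀ y : Q, Function.Bijective fun x => act x y
  self_distrib : ∀ x y z : Q, act (act x y) z = act (act x z) (act y z)

namespace YBRack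

variable {Q : Type*} {A : Type*} [CommRing A]

/-- Right translation by `y` as a permutation of `Q`. -/
def rho (R : YBRack Q) (y : Q) : Equiv.Perm Q :=
  Equiv.ofBijective _ (R.act_bijective y)

/-- The inner automorphism group of a rack: the subgroup of `Perm Q` generated
by all right translations. -/
def Inn (R : YBRack Q) : Subgroup (Equiv.Perm Q) :=
  Subgroup.closure (Set.range R.rho)

/-- Behavioural equivalence: `x ≡ y` iff `ϱ(x) = ϱ(y)`. -/
def BEquiv (R : YBRack Q) (x y : Q) : Prop := R.rho x = R.rho y

end YBRack
/-- Matrix of a linear endomorphism of `AQ ⊗ AQ`, via the identification of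
`AQ ⊗ AQ` with the free module on `Q × Q`. -/
def mat2 (A : Type*) [CommRing A] {Q : Type*}
    (f : ((Q →₀ A) ⊗[A] (Q →₀ A)) →ₗ[A] ((Q →₀ A) ⊗[A] (Q →₀ A))) (p q : Q × Q) : A :=
  finsuppTensorFinsupp' A Q Q (f ((finsuppTensorFinsupp' A Q Q).symm (Finsupp.single p 1))) q

/-- Matrix of a linear endomorphism of `AQ`. -/
def mat1 (A : Type*) [CommRing A] {Q : Type*}
    (f : (Q →₀ A) →ₗ[A] (Q →₀ A)) (x u : Q) : A :=
  f (Finsupp.single x 1) u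

/-- The Yang–Baxter (braid) equation for an endomorphism of `M ⊗ M`, where
`c₁ = c ⊗ id` and `c₂ = id ⊗ c` act on `(M ⊗ M) ⊗ M`. -/
def YBE {A M : Type*} [CommRing A] [AddCommGroup M] [Module A M]
    (c : (M ⊗[A] M) →ₗ[A] (M ⊗[A] M)) : Prop :=
  (LinearMap.rTensor M c) ∘ₗ
      ((TensorProduct.assoc A M M M).symm.toLinearMap ∘ₗ (LinearMap.lTensor M c) ∘ₗ
        (TensorProduct.assoc A M M M).toLinearMap) ∘ₗ (LinearMap.rTensor M c)
    = ((TensorProduct.assoc A M M M).symm.toLinearMap ∘ₗ (LinearMap.lTensor M c) ∘ₗ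
        (TensorProduct.assoc A M M M).toLinearMap) ∘ₗ (LinearMap.rTensor M c) ∘ₗ
      ((TensorProduct.assoc A M M M).symm.toLinearMap ∘ₗ (LinearMap.lTensor M c) ∘ₗ
        (TensorProduct.assoc A M M M).toLinearMap)

/-- A Yang–Baxter operator: a bijective linear endomorphism of `M ⊗ M`
satisfying the Yang–Baxter equation. -/
def IsYBOp {A M : Type*} [CommRing A] [AddCommGroup M] [Module A M]
    (c : (M ⊗[A] M) →ₗ[A] (M ⊗[A] M)) : Prop :=
  Function.Bijective c ∧ YBE c

/-- An endomorphism of `AQ ⊗ AQ` is entropic (with respect to the rack `R`)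
if its matrix is quasi-diagonal and fully equivariant. -/
def Entropic2 {Q : Type*} (R : YBRack Q) (A : Type*) [CommRing A]
    (f : ((Q →₀ A) ⊗[A] (Q →₀ A)) →ₗ[A] ((Q →₀ A) ⊗[A] (Q →₀ A))) : Prop :=
  (∀ x y u v : Q, (¬ R.BEquiv x u ∨ ¬ R.BEquiv y v) → mat2 A f (x, y) (u, v) = 0) ∧
  (∀ (x y u v : Q) (α β : R.Inn),
    mat2 A f ((α : Equiv.Perm Q) x, (β : Equiv.Perm Q) y)
        ((α : Equiv.Perm Q) u, (β : Equiv.Perm Q) v)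
      = mat2 A f (x, y) (u, v))

open scoped Classical in
/-- Two Yang–Baxter operators are equivalent with respect to the ideal `m` if
they are conjugate by `α ⊗ α` for some automorphism `α` of `AQ` congruent to
the identity modulo `m`. -/
def YBEquivalent {Q A : Type*} [CommRing A] (m : Ideal A)
    (c c' : ((Q →₀ A) ⊗[A] (Q →₀ A)) →ₗ[A] ((Q →₀ A) ⊗[A] (Q →₀ A))) : Prop :=
  ∃ α : (Q →₀ A) ≃ₗ[A] (Q →₀ A),
    (∀ x u : Q, (α (Finsupp.single x 1)) u - (if x = u then 1 else 0) ∈ m) ∧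
    c' = (TensorProduct.congr α α).toLinearMap ∘ₗ c ∘ₗ (TensorProduct.congr α α).symm.toLinearMap

section Auxiliary

variable {A Q : Type*} [CommRing A]

section SquareZero

variable {m : Ideal A} {M N P : Type*} [AddCommGroup M] [Module A M] [AddCommGroup N] [Module A N]
  [AddCommGroup P] [Module A P]

theorem LinearMap.map_mem_ideal_smul_top (g : M →ₗ[A] N) {t : M}
    (ht : t ∈ m • (⊤ : Submodule A M)) : g t ∈ m • (⊤ : Submodule A N) := by
  have h := Submodule.mem_map_of_mem (f := g) ht
  rw [Submodule.map_smul''] at h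
  exact Submodule.smul_mono le_rfl le_top h

theorem LinearMap.comp_eq_zero_of_range_le (hm : m * m = ⊥) {g : N →ₗ[A] P} {h : M →ₗ[A] N}
    (hg : g.range ≤ m • ⊤) (hh : h.range ≤ m • ⊤) : g ∘ₗ h = 0 := by
  ext t
  have h1 : g (h t) ∈ (m • (⊤ : Submodule A N)).map g :=
    Submodule.mem_map_of_mem (hh ⟨t, rfl⟩)
  rw [Submodule.map_smul'', Submodule.map_top] at h1
  have h2 := Submodule.smul_mono le_rfl hg h1
  rw [← Submodule.mul_smul, hm, Submodule.bot_smul] at h2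
  simpa using h2

theorem LinearMap.range_comp_le_smul_top (g : N →ₗ[A] P) {h : M →ₗ[A] N}
    (hh : h.range ≤ m • ⊤) : (g ∘ₗ h).range ≤ m • ⊤ := by
  rintro _ ⟨t, rfl⟩
  exact g.map_mem_ideal_smul_top (hh ⟨t, rfl⟩)

theorem LinearMap.range_rTensor_le_smul_top {g : M →ₗ[A] N}
    (hg : g.range ≤ m • ⊤) : (g.rTensor P).range ≤ m • ⊤ := by
  rintro _ ⟨t, rfl⟩
  induction t with
  | zero => simp
  | add s t hs ht => rw [map_add]; exact add_mem hs ht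
  | tmul s p =>
    exact ((TensorProduct.mk A N P).flip p).map_mem_ideal_smul_top (hg ⟨s, rfl⟩)

theorem LinearMap.range_lTensor_le_smul_top {g : M →ₗ[A] N}
    (hg : g.range ≤ m • ⊤) : (g.lTensor P).range ≤ m • ⊤ := by
  rintro _ ⟨t, rfl⟩
  induction t with
  | zero => simp
  | add s t hs ht => rw [map_add]; exact add_mem hs ht
  | tmul p s =>
    exact (TensorProduct.mk A P N p).map_mem_ideal_smul_top (hg ⟨s, rfl⟩)

end SquareZero

theorem mul_one_add_mul_one_add_mul_one_add {S : Type*} [Ring S] {a b c x y z : S}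
    (hxy : x * b * y = 0) (hyz : y * c * z = 0) (hxz : x * (b * c) * z = 0) :
    a * (1 + x) * (b * (1 + y) * (c * (1 + z)))
      = a * b * c + a * x * b * c + a * b * y * c + a * b * c * z := by
  have : a * (1 + x) * (b * (1 + y) * (c * (1 + z)))
      = a * b * c + a * x * b * c + a * b * y * c + a * b * c * z
        + (a * (x * b * y) * c * (1 + z) + a * b * (y * c * z) + a * (x * (b * c) * z)) := by
    noncomm_ring
  rw [this, hxy, hyz, hxz]
  simp

theorem braid_mul_one_add {S : Type*} [Ring S] {c d x y : S}
    (hxx : ∀ s, x * s * x = 0) (hxy : ∀ s, x * s * y = 0) (hyx : ∀ s, y * s * x = 0)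
    (hyy : ∀ s, y * s * y = 0) (hcd : c * d * c = d * c * d)
    (hleft : c * x * d * c = d * c * d * y) (hmid : c * d * y * c = d * c * x * d)
    (hright : c * d * c * x = d * y * c * d) :
    c * (1 + x) * (d * (1 + y) * (c * (1 + x))) = d * (1 + y) * (c * (1 + x) * (d * (1 + y))) := by
  rw [mul_one_add_mul_one_add_mul_one_add (hxy _) (hyx _) (hxx _),
    mul_one_add_mul_one_add_mul_one_add (hyx _) (hxy _) (hyy _), hcd, hleft, hmid, ← hright, hcd]
  abel

section RackModule

variable {M N : Type*} [AddCommGroup M] [Module A M] [AddCommGroup N] [Module A N]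
  (b : Module.Basis Q A M) {R : YBRack Q} {g cQ : M ⊗[A] M →ₗ[A] M ⊗[A] M}

theorem Module.Basis.linearMap_ext_tmul {h k : M ⊗[A] M →ₗ[A] N}
    (H : ∀ x y, h (b x ⊗ₜ b y) = k (b x ⊗ₜ b y)) : h = k :=
  (b.tensorProduct b).ext fun ⟨x, y⟩ => by simpa using H x y

theorem Module.Basis.linearMap_ext_tmul_tmul {h k : (M ⊗[A] M) ⊗[A] M →ₗ[A] N}
    (H : ∀ x y z, h ((b x ⊗ₜ b y) ⊗ₜ b z) = k ((b x ⊗ₜ b y) ⊗ₜ b z)) : h = k :=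
  ((b.tensorProduct b).tensorProduct b).ext fun ⟨⟨x, y⟩, z⟩ => by simpa using H x y z

theorem Module.Basis.mem_of_repr_smul_mem {ι : Type*} (e : Module.Basis ι A M)
    (S : Submodule A M) (t : M) (h : ∀ i, e.repr t i • e i ∈ S) : t ∈ S := by
  rw [← e.linearCombination_repr t, Finsupp.linearCombination_apply]
  exact Submodule.sum_mem _ fun i _ => h i

/-- The quasi-diagonal half of entropicity, with respect to the basis `b`. -/
def QuasiDiagonal (R : YBRack Q) (g : M ⊗[A] M →ₗ[A] M ⊗[A] M) : Prop :=
  ∀ x y, g (b x ⊗ₜ b y) ∈ Submodule.span A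
    {t | ∃ u v, R.BEquiv x u ∧ R.BEquiv y v ∧ t = b u ⊗ₜ b v}

/-- The permutation `σ` of one basis and the permutation `τ` of the other, acting on `M ⊗ M`. -/
def permMap (σ τ : Equiv.Perm Q) : M ⊗[A] M →ₗ[A] M ⊗[A] M :=
  TensorProduct.map (b.equiv b σ).toLinearMap (b.equiv b τ).toLinearMap

@[simp]
theorem permMap_tmul (σ τ : Equiv.Perm Q) (x y : Q) :
    permMap b σ τ (b x ⊗ₜ b y) = b (σ x) ⊗ₜ b (τ y) := by
  simp [permMap]

/-- The equivariant half of entropicity, with respect to the basis `b`. -/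
def FullyEquivariant (R : YBRack Q) (g : M ⊗[A] M →ₗ[A] M ⊗[A] M) : Prop :=
  ∀ α β : R.Inn, g ∘ₗ permMap b α β = permMap b α β ∘ₗ g

variable {b}

theorem quasiDiagonal_of_repr
    (hg : ∀ x y u v : Q, (¬ R.BEquiv x u ∨ ¬ R.BEquiv y v) →
      (b.tensorProduct b).repr (g (b x ⊗ₜ b y)) (u, v) = 0) : QuasiDiagonal b R g := by
  intro x y
  refine (b.tensorProduct b).mem_of_repr_smul_mem _ _ fun ⟨u, v⟩ => ?_
  by_cases h : R.BEquiv x u ∧ R.BEquiv y v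
  · exact Submodule.smul_mem _ _ (Submodule.subset_span ⟨u, v, h.1, h.2, by simp⟩)
  · rw [hg x y u v (not_and_or.mp h), zero_smul]
    exact zero_mem _

theorem repr_permMap (σ τ : Equiv.Perm Q) (t : M ⊗[A] M) (u v : Q) :
    (b.tensorProduct b).repr (permMap b σ τ t) (σ u, τ v) = (b.tensorProduct b).repr t (u, v) := by
  have h : (b.tensorProduct b).repr.toLinearMap ∘ₗ permMap b σ τ
      = Finsupp.lmapDomain A A (Prod.map σ τ) ∘ₗ (b.tensorProduct b).repr.toLinearMap := by
    refine b.linearMap_ext_tmul fun x y => ?_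
    simp only [LinearMap.comp_apply, permMap_tmul, LinearEquiv.coe_coe]
    simp only [← Module.Basis.tensorProduct_apply, Module.Basis.repr_self,
      Finsupp.lmapDomain_apply, Finsupp.mapDomain_single, Prod.map_apply]
  have h' := LinearMap.congr_fun h t
  simp only [LinearMap.comp_apply, LinearEquiv.coe_coe] at h'
  rw [h']
  exact Finsupp.mapDomain_apply (σ.injective.prodMap τ.injective) _ (u, v)

theorem fullyEquivariant_of_repr
    (hg : ∀ (x y u v : Q) (α β : R.Inn),
      (b.tensorProduct b).repr (g (b ((α : Equiv.Perm Q) x) ⊗ₜ b ((β : Equiv.Perm Q) y)))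
          ((α : Equiv.Perm Q) u, (β : Equiv.Perm Q) v)
        = (b.tensorProduct b).repr (g (b x ⊗ₜ b y)) (u, v)) : FullyEquivariant b R g := by
  intro α β
  refine b.linearMap_ext_tmul fun x y => (b.tensorProduct b).repr.injective ?_
  ext ⟨u, v⟩
  obtain ⟨u, rfl⟩ := (α : Equiv.Perm Q).surjective u
  obtain ⟨v, rfl⟩ := (β : Equiv.Perm Q).surjective v
  simp only [LinearMap.comp_apply, repr_permMap, permMap_tmul, hg]

theorem QuasiDiagonal.sub_id (hg : QuasiDiagonal b R g) :
    QuasiDiagonal b R (g - LinearMap.id) := fun x y =>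
  Submodule.sub_mem _ (hg x y) (Submodule.subset_span ⟨x, y, rfl, rfl, rfl⟩)

theorem FullyEquivariant.sub_id (hg : FullyEquivariant b R g) :
    FullyEquivariant b R (g - LinearMap.id) := fun α β => by
  rw [LinearMap.sub_comp, LinearMap.comp_sub, hg α β, LinearMap.id_comp, LinearMap.comp_id]

theorem QuasiDiagonal.map_eq (hg : QuasiDiagonal b R g) {h k : M ⊗[A] M →ₗ[A] N} {x y : Q}
    (H : ∀ u v, R.rho x = R.rho u → R.rho y = R.rho v → h (b u ⊗ₜ b v) = k (b u ⊗ₜ b v)) :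
    h (g (b x ⊗ₜ b y)) = k (g (b x ⊗ₜ b y)) := by
  refine LinearMap.eqOn_span ?_ (hg x y)
  rintro _ ⟨u, v, hu, hv, rfl⟩
  exact H u v hu hv

theorem YBRack.rho_apply (R : YBRack Q) (x y : Q) : R.rho y x = R.act x y := rfl

theorem YBRack.act_congr_right {x y v : Q} (h : R.rho y = R.rho v) : R.act x v = R.act x y :=
  (Equiv.congr_fun h x).symm

theorem YBRack.rho_mem_Inn (R : YBRack Q) (y : Q) : R.rho y ∈ R.Inn :=
  Subgroup.subset_closure ⟨y, rfl⟩

theorem FullyEquivariant.apply_act_act (hg : FullyEquivariant b R g) (x y z : Q) :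
    g (b (R.act x z) ⊗ₜ b (R.act y z)) = permMap b (R.rho z) (R.rho z) (g (b x ⊗ₜ b y)) := by
  have h := LinearMap.congr_fun (hg ⟨_, R.rho_mem_Inn z⟩ ⟨_, R.rho_mem_Inn z⟩) (b x ⊗ₜ b y)
  simpa [YBRack.rho_apply] using h

theorem FullyEquivariant.apply_act_left (hg : FullyEquivariant b R g) (x y z : Q) :
    g (b (R.act x z) ⊗ₜ b y) = permMap b (R.rho z) 1 (g (b x ⊗ₜ b y)) := by
  have h := LinearMap.congr_fun (hg ⟨_, R.rho_mem_Inn z⟩ 1) (b x ⊗ₜ b y)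
  simpa [YBRack.rho_apply] using h

theorem range_sub_id_le_smul_top {m : Ideal A}
    (hg : ∀ x y p, (b.tensorProduct b).repr (g (b x ⊗ₜ b y) - b x ⊗ₜ b y) p ∈ m) :
    (g - LinearMap.id).range ≤ m • ⊤ := by
  rintro _ ⟨t, rfl⟩
  have h : ∀ x y, g (b x ⊗ₜ b y) - b x ⊗ₜ b y ∈ m • (⊤ : Submodule A (M ⊗[A] M)) := fun x y =>
    (b.tensorProduct b).mem_of_repr_smul_mem _ _ fun p =>
      Submodule.smul_mem_smul (hg x y p) Submodule.mem_top
  have ht : t ∈ (m • (⊤ : Submodule A (M ⊗[A] M))).comap (g - LinearMap.id) := by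
    refine (b.tensorProduct b).mem_of_repr_smul_mem _ _ fun ⟨x, y⟩ => Submodule.smul_mem _ _ ?_
    rw [Module.Basis.tensorProduct_apply]
    exact h x y
  exact ht

theorem YBRack.bijective_of_apply_tmul
    (hcQ : ∀ x y, cQ (b x ⊗ₜ b y) = b y ⊗ₜ b (R.act x y)) : Function.Bijective cQ := by
  have hb : Function.Bijective fun p : Q × Q => (p.2, R.act p.1 p.2) := by
    constructor
    · rintro ⟨x, y⟩ ⟨u, v⟩ h
      obtain ⟨rfl, h⟩ := Prod.mk.inj h
      exact Prod.ext ((R.act_bijective y).1 h) rfl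
    · rintro ⟨y, w⟩
      obtain ⟨x, rfl⟩ := (R.act_bijective y).2 w
      exact ⟨(x, y), rfl⟩
  have h : cQ = ((b.tensorProduct b).equiv (b.tensorProduct b)
      (Equiv.ofBijective _ hb)).toLinearMap := by
    refine (b.tensorProduct b).ext fun ⟨x, y⟩ => ?_
    rw [LinearEquiv.coe_coe, Module.Basis.equiv_apply]
    simp [hcQ]
  rw [h]
  exact LinearEquiv.bijective _

/-- The operator `c ⊗ id` on `(M ⊗ M) ⊗ M`. -/
abbrev firstTensor (c : M ⊗[A] M →ₗ[A] M ⊗[A] M) : Module.End A ((M ⊗[A] M) ⊗[A] M) :=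
  LinearMap.rTensor M c

/-- The operator `id ⊗ c` on `(M ⊗ M) ⊗ M`. -/
abbrev secondTensor (c : M ⊗[A] M →ₗ[A] M ⊗[A] M) : Module.End A ((M ⊗[A] M) ⊗[A] M) :=
  (TensorProduct.assoc A M M M).symm.toLinearMap ∘ₗ (LinearMap.lTensor M c) ∘ₗ
    (TensorProduct.assoc A M M M).toLinearMap

theorem YBRack.firstTensor_mul_secondTensor_mul_firstTensor
    (hcQ : ∀ x y, cQ (b x ⊗ₜ b y) = b y ⊗ₜ b (R.act x y)) :
    firstTensor cQ * secondTensor cQ * firstTensor cQ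
      = secondTensor cQ * firstTensor cQ * secondTensor cQ := by
  refine b.linearMap_ext_tmul_tmul fun x y z => ?_
  simp [hcQ, R.self_distrib x y z]

theorem YBRack.mul_firstTensor_eq (hg : QuasiDiagonal b R g) (hg' : FullyEquivariant b R g)
    (hcQ : ∀ x y, cQ (b x ⊗ₜ b y) = b y ⊗ₜ b (R.act x y)) :
    firstTensor cQ * secondTensor cQ * firstTensor cQ * firstTensor g
      = secondTensor cQ * secondTensor g * firstTensor cQ * secondTensor cQ := by
  refine b.linearMap_ext_tmul_tmul fun x y z => ?_
  have key := hg.map_eq (x := x) (y := y)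
    (h := (firstTensor cQ * secondTensor cQ * firstTensor cQ) ∘ₗ
      (TensorProduct.mk A _ _).flip (b z))
    (k := secondTensor cQ ∘ₗ (TensorProduct.assoc A _ _ _).symm.toLinearMap ∘ₗ
      TensorProduct.mk A _ _ (b z) ∘ₗ permMap b (R.rho z) (R.rho z))
    fun u v _ _ => by simp [hcQ, YBRack.rho_apply, R.self_distrib u v z]
  simpa [hcQ, hg'.apply_act_act] using key

theorem YBRack.mul_secondTensor_mul_eq (hg : QuasiDiagonal b R g) (hg' : FullyEquivariant b R g)
    (hcQ : ∀ x y, cQ (b x ⊗ₜ b y) = b y ⊗ₜ b (R.act x y)) :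
    firstTensor cQ * secondTensor cQ * secondTensor g * firstTensor cQ
      = secondTensor cQ * firstTensor cQ * firstTensor g * secondTensor cQ := by
  refine b.linearMap_ext_tmul_tmul fun x y z => ?_
  have key := hg.map_eq (x := x) (y := z)
    (h := (firstTensor cQ * secondTensor cQ) ∘ₗ (TensorProduct.assoc A _ _ _).symm.toLinearMap ∘ₗ
      TensorProduct.mk A _ _ (b y) ∘ₗ permMap b (R.rho y) 1)
    (k := (secondTensor cQ * firstTensor cQ) ∘ₗ
      (TensorProduct.mk A _ _).flip (b (R.act y z)))
    fun u v _ hv => by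
      simp [hcQ, YBRack.rho_apply, YBRack.act_congr_right hv, R.self_distrib u y z]
  simpa [hcQ, hg'.apply_act_left] using key

theorem YBRack.mul_firstTensor_mul_eq (hg : QuasiDiagonal b R g)
    (hcQ : ∀ x y, cQ (b x ⊗ₜ b y) = b y ⊗ₜ b (R.act x y)) :
    firstTensor cQ * firstTensor g * secondTensor cQ * firstTensor cQ
      = secondTensor cQ * firstTensor cQ * secondTensor cQ * secondTensor g := by
  refine b.linearMap_ext_tmul_tmul fun x y z => ?_
  have key := hg.map_eq (x := y) (y := z)
    (h := firstTensor cQ ∘ₗ (TensorProduct.mk A _ _).flip (b (R.act (R.act x y) z)))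
    (k := (secondTensor cQ * firstTensor cQ * secondTensor cQ) ∘ₗ
      (TensorProduct.assoc A _ _ _).symm.toLinearMap ∘ₗ TensorProduct.mk A _ _ (b x))
    fun u v hu hv => by
      have h : R.act (R.act x z) (R.act u z) = R.act (R.act x y) z := by
        rw [← R.self_distrib, YBRack.act_congr_right hu]
      simp [hcQ, YBRack.act_congr_right hv, h]
  simpa [hcQ] using key

/-- The infinitesimal deformation theorem over a free module with basis `b` indexed by a rack. -/
theorem bijective_and_YBE_comp_of_sq_zero {m : Ideal A} (hm : m * m = ⊥)
    (hcQ : ∀ x y, cQ (b x ⊗ₜ b y) = b y ⊗ₜ b (R.act x y)) {f : M ⊗[A] M →ₗ[A] M ⊗[A] M}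
    (hqd : QuasiDiagonal b R f) (heq : FullyEquivariant b R f)
    (hrange : (f - LinearMap.id).range ≤ m • ⊤) :
    Function.Bijective f ∧ Function.Bijective (cQ ∘ₗ f) ∧ YBE (cQ ∘ₗ f) := by
  obtain ⟨g, rfl⟩ : ∃ g, f = LinearMap.id + g := ⟨f - LinearMap.id, by simp⟩
  replace hqd := hqd.sub_id
  replace heq := heq.sub_id
  rw [add_sub_cancel_left] at hqd heq hrange
  have hgg : ∀ t, g (g t) = 0 := fun t =>
    LinearMap.congr_fun (LinearMap.comp_eq_zero_of_range_le hm hrange hrange) t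
  have hfbij : Function.Bijective (LinearMap.id + g : M ⊗[A] M →ₗ[A] M ⊗[A] M) := by
    refine Function.bijective_iff_has_inverse.mpr ⟨fun t => t - g t, fun t => ?_, fun t => ?_⟩ <;>
      simp [hgg]
  refine ⟨hfbij, (YBRack.bijective_of_apply_tmul hcQ).comp hfbij, ?_⟩
  have h1 : (firstTensor g).range ≤ m • ⊤ := LinearMap.range_rTensor_le_smul_top hrange
  have h2 : (secondTensor g).range ≤ m • ⊤ :=
    LinearMap.range_comp_le_smul_top _
      ((LinearMap.range_comp_le_range _ _).trans (LinearMap.range_lTensor_le_smul_top hrange))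
  have hzero : ∀ {a b : Module.End A ((M ⊗[A] M) ⊗[A] M)}
      (c : Module.End A ((M ⊗[A] M) ⊗[A] M)),
      a.range ≤ m • ⊤ → b.range ≤ m • ⊤ → a * c * b = 0 := fun c ha hb =>
    LinearMap.comp_eq_zero_of_range_le hm ((LinearMap.range_comp_le_range _ _).trans ha) hb
  have hc1 : firstTensor (cQ ∘ₗ (LinearMap.id + g)) = firstTensor cQ * (1 + firstTensor g) := by
    refine LinearMap.ext fun t => ?_
    simp [LinearMap.rTensor_comp, LinearMap.rTensor_add]
  have hc2 : secondTensor (cQ ∘ₗ (LinearMap.id + g)) = secondTensor cQ * (1 + secondTensor g) := by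
    refine LinearMap.ext fun t => ?_
    simp [LinearMap.lTensor_comp, LinearMap.lTensor_add]
  change firstTensor (cQ ∘ₗ (LinearMap.id + g)) *
      (secondTensor (cQ ∘ₗ (LinearMap.id + g)) * firstTensor (cQ ∘ₗ (LinearMap.id + g)))
    = secondTensor (cQ ∘ₗ (LinearMap.id + g)) *
      (firstTensor (cQ ∘ₗ (LinearMap.id + g)) * secondTensor (cQ ∘ₗ (LinearMap.id + g)))
  rw [hc1, hc2]
  exact braid_mul_one_add (fun s => hzero s h1 h1) (fun s => hzero s h1 h2)
    (fun s => hzero s h2 h1) (fun s => hzero s h2 h2)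
    (YBRack.firstTensor_mul_secondTensor_mul_firstTensor hcQ)
    (YBRack.mul_firstTensor_mul_eq hqd hcQ) (YBRack.mul_secondTensor_mul_eq hqd heq hcQ)
    (YBRack.mul_firstTensor_eq hqd heq hcQ)

end RackModule

end Auxiliary

open scoped Classical in
/-- Infinitesimal case `m² = 0`: if `f` is an entropic `A`-linear
map on `AQ ⊗ AQ` whose matrix is congruent to the identity modulo `m`, then `f` is
an automorphism and `c_Q ∘ f` is a Yang–Baxter operator. -/
theorem entropic_infinitesimal_deformation_is_YB
    {A Q : Type*} [CommRing A] (R : YBRack Q) (m : Ideal A) (hm : m * m = ⊥)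
    (cQ : ((Q →₀ A) ⊗[A] (Q →₀ A)) →ₗ[A] ((Q →₀ A) ⊗[A] (Q →₀ A)))
    (hcQ : ∀ x y : Q,
      cQ (Finsupp.single x (1 : A) ⊗ₜ[A] Finsupp.single y (1 : A))
        = Finsupp.single y (1 : A) ⊗ₜ[A] Finsupp.single (R.act x y) (1 : A))
    (f : ((Q →₀ A) ⊗[A] (Q →₀ A)) →ₗ[A] ((Q →₀ A) ⊗[A] (Q →₀ A)))
    (hent : Entropic2 R A f)
    (hmod : ∀ p q : Q × Q, mat2 A f p q - (if p = q then 1 else 0) ∈ m) :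
    Function.Bijective f ∧ Function.Bijective (cQ ∘ₗ f) ∧ YBE (cQ ∘ₗ f) := by
  let b : Module.Basis Q A (Q →₀ A) := Finsupp.basisSingleOne
  have hmat : ∀ x y p, mat2 A f (x, y) p = (b.tensorProduct b).repr (f (b x ⊗ₜ b y)) p := by
    intro x y p
    have h : (b.tensorProduct b).repr = finsuppTensorFinsupp' A Q Q := by
      refine (b.tensorProduct b).ext' fun ⟨u, v⟩ => ?_
      rw [Module.Basis.repr_self, Module.Basis.tensorProduct_apply]
      simp [b]
    have hxy : (finsuppTensorFinsupp' A Q Q).symm (Finsupp.single (x, y) 1) = b x ⊗ₜ b y := by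
      rw [LinearEquiv.symm_apply_eq]
      simp [b]
    rw [mat2, h, hxy]
  refine bijective_and_YBE_comp_of_sq_zero (b := b) hm hcQ
    (quasiDiagonal_of_repr ?_) (fullyEquivariant_of_repr ?_)
    (range_sub_id_le_smul_top (b := b) ?_)
  · intro x y u v h
    exact (hmat x y (u, v)).symm.trans (hent.1 x y u v h)
  · intro x y u v α β
    exact (hmat _ _ _).symm.trans ((hent.2 x y u v α β).trans (hmat _ _ _))
  · intro x y p
    have h := hmod (x, y) p
    rw [hmat] at h
    rw [map_sub, ← Module.Basis.tensorProduct_apply, Module.Basis.repr_self]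
    simpa [Finsupp.single_apply] using h

end
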